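/- Let $0 < r \le R < \infty$ and let $h : B'(2R) \times (-r, r) \to \mathbb{R}$ be harmonic, where $B'(2R) \subset \mathbb{R}^2$ is the disk of radius $2R$. Then for all $0 < \rho \le r/4$ and all $1 \le \ell \le q < \infty$, $$\|h\|_{L^q(B'(R) \times (-\rho,\rho))}^q \le C \, \rho \, r^{2 - \frac{3q}{\ell}} \, \|h\|_{L^\ell(B'(2R) \times (-r,r))}^q,$$ where $C$ depends only on $q$ and $\ell$. -/

import Mathlib

open MeasureTheory ENNReal Set

/-- The slab `B'(R) × (-ρ, ρ) ⊂ ℝ³`. -/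
def slab (R ρ : ℝ) : Set (Fin 3 → ℝ) :=
  {x | (x 0) ^ 2 + (x 1) ^ 2 < R ^ 2 ∧ |x 2| < ρ}

/-- `h` is harmonic on the open set `S`: smooth with vanishing Laplacian. -/
def IsHarmonicOn (h : (Fin 3 → ℝ) → ℝ) (S : Set (Fin 3 → ℝ)) : Prop :=
  ContDiffOn ℝ (⊤ : ℕ∞) h S ∧
    ∀ x ∈ S, (∑ i : Fin 3,
      fderiv ℝ (fun y => fderiv ℝ h y (Pi.single i 1)) x (Pi.single i 1)) = 0

/-- Smooth radial cutoff. -/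
noncomputable def zetaF (y : Fin 3 → ℝ) : ℝ :=
  Real.smoothTransition (1 - ∑ i, (y i) ^ 2)

/-- Radial kernel, with `∂_i zetaF = - y_i etaF`. -/
noncomputable def etaF (y : Fin 3 → ℝ) : ℝ :=
  2 * deriv Real.smoothTransition (1 - ∑ i, (y i) ^ 2)

lemma contDiff_zetaF : ContDiff ℝ (⊤ : ℕ∞) zetaF := by
  unfold zetaF
  exact Real.smoothTransition.contDiff.comp (by fun_prop)

lemma continuous_etaF : Continuous etaF := by
  unfold etaF
  have h : Continuous (deriv Real.smoothTransition) :=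
    (Real.smoothTransition.contDiff (n := 1)).continuous_deriv le_rfl
  exact continuous_const.mul (h.comp (by fun_prop))

lemma norm_lt_one_of_sum {y : Fin 3 → ℝ} (h : ∑ i, (y i) ^ 2 < 1) : ‖y‖ < 1 := by
  rw [pi_norm_lt_iff one_pos]
  intro i
  have : (y i) ^ 2 ≤ ∑ i, (y i) ^ 2 :=
    Finset.single_le_sum (f := fun i => (y i) ^ 2) (fun j _ => sq_nonneg _) (Finset.mem_univ i)
  rw [Real.norm_eq_abs, ← sq_lt_one_iff_abs_lt_one]
  linarith

lemma zetaF_eq_zero {y : Fin 3 → ℝ} (h : 1 ≤ ‖y‖) : zetaF y = 0 := by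
  have : ¬ (∑ i, (y i) ^ 2 < 1) := fun hh => absurd (norm_lt_one_of_sum hh) (not_lt.2 h)
  exact Real.smoothTransition.zero_of_nonpos (by linarith)

lemma deriv_st_nonneg (s : ℝ) : 0 ≤ deriv Real.smoothTransition s :=
  Real.smoothTransition.monotone.deriv_nonneg

lemma deriv_st_zero {s : ℝ} (h : s ≤ 0) : deriv Real.smoothTransition s = 0 := by
  have : IsLocalMin Real.smoothTransition s := by
    refine Filter.Eventually.of_forall fun z => ?_
    rw [Real.smoothTransition.zero_of_nonpos h]
    exact Real.smoothTransition.nonneg z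
  exact this.deriv_eq_zero

lemma etaF_eq_zero {y : Fin 3 → ℝ} (h : 1 ≤ ‖y‖) : etaF y = 0 := by
  have : ¬ (∑ i, (y i) ^ 2 < 1) := fun hh => absurd (norm_lt_one_of_sum hh) (not_lt.2 h)
  unfold etaF
  rw [deriv_st_zero (by linarith), mul_zero]

lemma compact_etaF : HasCompactSupport etaF := by
  refine HasCompactSupport.of_support_subset_isCompact (isCompact_closedBall (0 : Fin 3 → ℝ) 1) ?_
  intro y hy
  by_contra hh
  rw [mem_closedBall_zero_iff, not_le] at hh
  exact hy (etaF_eq_zero hh.le)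

lemma compact_zetaF : HasCompactSupport zetaF := by
  refine HasCompactSupport.of_support_subset_isCompact (isCompact_closedBall (0 : Fin 3 → ℝ) 1) ?_
  intro y hy
  by_contra hh
  rw [mem_closedBall_zero_iff, not_le] at hh
  exact hy (zetaF_eq_zero hh.le)

lemma etaF_integral_pos : 0 < ∫ y, etaF y := by
  have hd : Differentiable ℝ Real.smoothTransition :=
    (Real.smoothTransition.contDiff (n := 1)).differentiable (by norm_num)
  obtain ⟨c, hc, hc'⟩ := exists_deriv_eq_slope Real.smoothTransition (zero_lt_one' ℝ)
    Real.smoothTransition.continuous.continuousOn hd.differentiableOn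
  refine continuous_etaF.integral_pos_of_hasCompactSupport_nonneg_nonzero compact_etaF
    (x := Pi.single 0 (√(1 - c))) ?_ ?_
  · intro y
    exact mul_nonneg zero_le_two (deriv_st_nonneg _)
  · unfold etaF
    have : (1 - ∑ i : Fin 3, ((Pi.single 0 (√(1 - c)) : Fin 3 → ℝ) i) ^ 2) = c := by
      simp [Fin.sum_univ_three]
      rw [Real.sq_sqrt (by linarith [hc.2])]; ring
    rw [this, hc']
    simp

lemma fderiv_zetaF (y : Fin 3 → ℝ) (i : Fin 3) :
    fderiv ℝ zetaF y (Pi.single i 1) = - (y i * etaF y) := by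
  have hd : Differentiable ℝ Real.smoothTransition :=
    (Real.smoothTransition.contDiff (n := 1)).differentiable (by norm_num)
  have h1 : HasFDerivAt (fun y : Fin 3 → ℝ => 1 - ∑ i, (y i) ^ 2)
      (-(∑ i, (2 * y i) • ContinuousLinearMap.proj (R := ℝ) (φ := fun _ : Fin 3 => ℝ) i)) y := by
    have : ∀ i ∈ (Finset.univ : Finset (Fin 3)), HasFDerivAt (fun y : Fin 3 → ℝ => (y i) ^ 2)
        ((2 * y i) • ContinuousLinearMap.proj (R := ℝ) (φ := fun _ : Fin 3 => ℝ) i) y := by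
      intro i _
      have := (hasFDerivAt_apply (𝕜 := ℝ) i y).pow 2
      simpa using this
    exact (HasFDerivAt.fun_sum this).const_sub 1
  have h2 := ((hd (1 - ∑ i, (y i) ^ 2)).hasDerivAt.comp_hasFDerivAt y h1).fderiv
  change fderiv ℝ (Real.smoothTransition ∘ (fun y : Fin 3 → ℝ => 1 - ∑ i, (y i) ^ 2)) y _ = _
  rw [h2]
  simp [etaF, Pi.single_apply]
  ring

lemma mean_value_aux (g : (Fin 3 → ℝ) → ℝ) (hg : ContDiff ℝ (⊤ : ℕ∞) g)
    (x : Fin 3 → ℝ) (t δ : ℝ) (ht : |t| ≤ δ) (hδ : 0 < δ)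
    (hΔ : ∀ z ∈ Metric.ball x δ, (∑ i : Fin 3,
      fderiv ℝ (fun y => fderiv ℝ g y (Pi.single i 1)) z (Pi.single i 1)) = 0) :
    ∫ y, fderiv ℝ g (x + t • y) y * etaF y = 0 := by
  have hsm : ∀ i : Fin 3, ContDiff ℝ (⊤ : ℕ∞) (fun y => fderiv ℝ g y (Pi.single i 1)) :=
    fun i => (hg.fderiv_right (m := (⊤ : ℕ∞)) (by simp)).clm_apply contDiff_const
  set G : Fin 3 → (Fin 3 → ℝ) → ℝ := fun i y => fderiv ℝ g (x + t • y) (Pi.single i 1) with hG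
  have hGs : ∀ i, ContDiff ℝ (⊤ : ℕ∞) (G i) := fun i => (hsm i).comp (by fun_prop)
  have hGd : ∀ i y, fderiv ℝ (G i) y (Pi.single i 1)
      = t * fderiv ℝ (fun y => fderiv ℝ g y (Pi.single i 1)) (x + t • y) (Pi.single i 1) := by
    intro i y
    have h1 : HasFDerivAt (fun y : Fin 3 → ℝ => x + t • y)
        (t • ContinuousLinearMap.id ℝ (Fin 3 → ℝ)) y :=
      ((hasFDerivAt_id y).const_smul t).const_add x
    have h2 := (((hsm i).differentiable (by simp) (x + t • y)).hasFDerivAt.comp y h1).fderiv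
    change fderiv ℝ ((fun y => fderiv ℝ g y (Pi.single i 1)) ∘ fun y => x + t • y) y _ = _
    rw [h2]
    simp
  have hzc : ∀ i, Continuous fun y => fderiv ℝ zetaF y (Pi.single i 1) := fun i =>
    (contDiff_zetaF.continuous_fderiv (by simp)).clm_apply continuous_const
  have hGdc : ∀ i, Continuous fun y => fderiv ℝ (G i) y (Pi.single i 1) := fun i =>
    ((hGs i).continuous_fderiv (by simp)).clm_apply continuous_const
  have i1 : ∀ i, Integrable fun y => fderiv ℝ (G i) y (Pi.single i 1) * zetaF y := fun i =>
    ((hGdc i).mul contDiff_zetaF.continuous).integrable_of_hasCompactSupport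
      compact_zetaF.mul_left
  have i2 : ∀ i, Integrable fun y => G i y * fderiv ℝ zetaF y (Pi.single i 1) := fun i =>
    ((hGs i).continuous.mul (hzc i)).integrable_of_hasCompactSupport
      (HasCompactSupport.mul_left (compact_zetaF.fderiv_apply ℝ _))
  have i3 : ∀ i, Integrable fun y => G i y * zetaF y := fun i =>
    ((hGs i).continuous.mul contDiff_zetaF.continuous).integrable_of_hasCompactSupport
      compact_zetaF.mul_left
  have ibp : ∀ i, ∫ y, G i y * fderiv ℝ zetaF y (Pi.single i 1)
      = - ∫ y, fderiv ℝ (G i) y (Pi.single i 1) * zetaF y := fun i =>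
    integral_mul_fderiv_eq_neg_fderiv_mul_of_integrable (i1 i) (i2 i) (i3 i)
      (fun y _ => (hGs i).differentiable (by simp) y)
      (fun y _ => contDiff_zetaF.differentiable (by simp) y)
  have e1 : ∀ y, fderiv ℝ g (x + t • y) y * etaF y
      = - ∑ i, G i y * fderiv ℝ zetaF y (Pi.single i 1) := by
    intro y
    have hy : y = ∑ i, y i • (Pi.single i (1 : ℝ) : Fin 3 → ℝ) := by
      ext j; simp [Finset.sum_apply, Pi.single_apply]
    have : fderiv ℝ g (x + t • y) y = ∑ i, y i * G i y := by
      conv_lhs => arg 2; rw [hy]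
      rw [map_sum]
      simp [hG]
    rw [this, Finset.sum_mul, ← Finset.sum_neg_distrib]
    refine Finset.sum_congr rfl fun i _ => ?_
    rw [fderiv_zetaF]; ring
  simp_rw [e1]
  rw [integral_neg, integral_finsetSum _ (fun i _ => i2 i)]
  simp_rw [ibp]
  rw [Finset.sum_neg_distrib, neg_neg, ← integral_finsetSum _ (fun i _ => i1 i)]
  refine integral_eq_zero_of_ae (Filter.Eventually.of_forall fun y => ?_)
  simp only [Pi.zero_apply]
  by_cases hy : 1 ≤ ‖y‖
  · simp [zetaF_eq_zero hy]
  · rw [← Finset.sum_mul]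
    simp_rw [hGd]
    rw [← Finset.mul_sum, hΔ, mul_zero, zero_mul]
    rw [mem_ball_iff_norm, add_sub_cancel_left, norm_smul, Real.norm_eq_abs]
    push Not at hy
    nlinarith [norm_nonneg y, abs_nonneg t]

lemma mean_value_global (g : (Fin 3 → ℝ) → ℝ) (hg : ContDiff ℝ (⊤ : ℕ∞) g)
    (hc : HasCompactSupport g) (x : Fin 3 → ℝ) (δ : ℝ) (hδ : 0 < δ)
    (hΔ : ∀ z ∈ Metric.ball x δ, (∑ i : Fin 3,
      fderiv ℝ (fun y => fderiv ℝ g y (Pi.single i 1)) z (Pi.single i 1)) = 0) :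
    ∫ y, g (x + δ • y) * etaF y = g x * ∫ y, etaF y := by
  have hfc : Continuous (fderiv ℝ g) := hg.continuous_fderiv (by simp)
  obtain ⟨M, hM⟩ := (hc.fderiv (𝕜 := ℝ)).exists_bound_of_continuous hfc
  have hgc := hg.continuous
  have hec := continuous_etaF
  have key : ∀ t : ℝ, HasDerivAt (fun t : ℝ => ∫ y, g (x + t • y) * etaF y)
      (∫ y, fderiv ℝ g (x + t • y) y * etaF y) t := by
    intro t
    refine (hasDerivAt_integral_of_dominated_loc_of_deriv_le (𝕜 := ℝ) (μ := volume) (s := univ)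
      (F := fun (t : ℝ) (y : Fin 3 → ℝ) => g (x + t • y) * etaF y)
      (F' := fun (t : ℝ) (y : Fin 3 → ℝ) => fderiv ℝ g (x + t • y) y * etaF y)
      (bound := fun y => M * (‖y‖ * ‖etaF y‖)) Filter.univ_mem ?_ ?_ ?_ ?_ ?_ ?_).2
    · refine Filter.Eventually.of_forall fun s => Continuous.aestronglyMeasurable ?_
      fun_prop
    · exact Continuous.integrable_of_hasCompactSupport (by fun_prop) compact_etaF.mul_left
    · refine Continuous.aestronglyMeasurable ?_
      exact ((hfc.comp (by fun_prop)).clm_apply continuous_id).mul hec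
    · refine Filter.Eventually.of_forall fun y s _ => ?_
      rw [norm_mul, ← mul_assoc]
      gcongr
      exact (ContinuousLinearMap.le_opNorm _ _).trans (by gcongr; exact hM _)
    · exact (Continuous.integrable_of_hasCompactSupport (by fun_prop)
        (compact_etaF.norm.mul_left)).const_mul M
    · refine Filter.Eventually.of_forall fun y s _ => ?_
      refine HasDerivAt.mul_const ?_ _
      have h1 : HasDerivAt (fun s : ℝ => x + s • y) y s := by
        simpa using ((hasDerivAt_id s).smul_const y).const_add x
      exact (hg.differentiable (by simp) (x + s • y)).hasFDerivAt.comp_hasDerivAt s h1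
  have h0 : ∀ t ∈ Icc 0 δ, (fun t : ℝ => ∫ y, g (x + t • y) * etaF y) t
      = (fun t : ℝ => ∫ y, g (x + t • y) * etaF y) 0 := by
    refine constant_of_has_deriv_right_zero
      (fun t _ => (key t).continuousAt.continuousWithinAt) (fun t ht => ?_)
    have := (key t).hasDerivWithinAt (s := Ici t)
    rwa [mean_value_aux g hg x t δ (by rw [abs_of_nonneg ht.1]; exact ht.2.le) hδ hΔ] at this
  have := h0 δ ⟨hδ.le, le_rfl⟩
  simp only [zero_smul, add_zero] at this
  rw [this, integral_const_mul]

lemma mean_value_local (h : (Fin 3 → ℝ) → ℝ) (S : Set (Fin 3 → ℝ)) (hS : IsOpen S)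
    (hh : IsHarmonicOn h S) (x : Fin 3 → ℝ) (δ δ' : ℝ) (hδ : 0 < δ) (hδ' : δ < δ')
    (hb : Metric.closedBall x δ' ⊆ S) :
    ‖h x‖ₑ * ‖∫ y, etaF y‖ₑ ≤
      ∫⁻ y in Metric.ball (0 : Fin 3 → ℝ) 1, ‖h (x + δ • y)‖ₑ * ‖etaF y‖ₑ := by
  let b : ContDiffBump x := ⟨δ, δ', hδ, hδ'⟩
  set g : (Fin 3 → ℝ) → ℝ := fun y => b y * h y with hgdef
  have hts : tsupport g ⊆ Metric.closedBall x δ' := by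
    have : tsupport (b : (Fin 3 → ℝ) → ℝ) = Metric.closedBall x δ' := b.tsupport_eq
    rw [← this]
    exact tsupport_mul_subset_left
  have hg : ContDiff ℝ (⊤ : ℕ∞) g := by
    rw [contDiff_iff_contDiffAt]
    intro y
    by_cases hy : y ∈ tsupport g
    · exact b.contDiff.contDiffAt.mul (hh.1.contDiffAt (hS.mem_nhds (hb (hts hy))))
    · exact contDiffAt_const.congr_of_eventuallyEq (notMem_tsupport_iff_eventuallyEq.1 hy)
  have hc : HasCompactSupport g := b.hasCompactSupport.mul_right
  have hge : ∀ z ∈ Metric.ball x δ, g =ᶠ[nhds z] h := by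
    intro z hz
    filter_upwards [Metric.isOpen_ball.mem_nhds hz] with w hw
    have : b w = 1 := b.one_of_mem_closedBall (Metric.ball_subset_closedBall hw)
    simp [hgdef, this]
  have hxs : ∀ z ∈ Metric.ball x δ, z ∈ S := fun z hz =>
    hb (Metric.closedBall_subset_closedBall hδ'.le (Metric.ball_subset_closedBall hz))
  have hΔ : ∀ z ∈ Metric.ball x δ, (∑ i : Fin 3,
      fderiv ℝ (fun y => fderiv ℝ g y (Pi.single i 1)) z (Pi.single i 1)) = 0 := by
    intro z hz
    rw [← hh.2 z (hxs z hz)]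
    refine Finset.sum_congr rfl fun i _ => ?_
    have : (fun y => fderiv ℝ g y (Pi.single i 1)) =ᶠ[nhds z]
        (fun y => fderiv ℝ h y (Pi.single i 1)) := by
      filter_upwards [Metric.isOpen_ball.mem_nhds hz] with w hw
      rw [(hge w hw).fderiv_eq]
    rw [this.fderiv_eq]
  have mv := mean_value_global g hg hc x δ hδ hΔ
  have hgx : g x = h x := (hge x (Metric.mem_ball_self hδ)).eq_of_nhds
  rw [← enorm_mul, ← hgx, ← mv]
  refine (enorm_integral_le_lintegral_enorm _).trans ?_
  rw [← lintegral_indicator Metric.isOpen_ball.measurableSet]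
  refine lintegral_mono fun y => ?_
  by_cases hy : y ∈ Metric.ball (0 : Fin 3 → ℝ) 1
  · rw [indicator_of_mem hy, enorm_mul]
    have : x + δ • y ∈ Metric.ball x δ := by
      rw [mem_ball_zero_iff] at hy
      rw [mem_ball_iff_norm, add_sub_cancel_left, norm_smul, Real.norm_eq_abs, abs_of_pos hδ]
      nlinarith
    rw [(hge _ this).eq_of_nhds]
  · rw [mem_ball_zero_iff, not_lt] at hy
    simp [etaF_eq_zero hy]

lemma lintegral_scale (F : (Fin 3 → ℝ) → ℝ≥0∞) (x : Fin 3 → ℝ) (δ : ℝ) (hδ : 0 < δ) :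
    ∫⁻ y in Metric.ball (0 : Fin 3 → ℝ) 1, F (x + δ • y) =
      ENNReal.ofReal ((δ ^ 3)⁻¹) * ∫⁻ z in Metric.ball x δ, F z := by
  rw [← lintegral_indicator Metric.isOpen_ball.measurableSet,
    ← lintegral_indicator Metric.isOpen_ball.measurableSet]
  have e : ∀ y, (Metric.ball (0 : Fin 3 → ℝ) 1).indicator (fun y => F (x + δ • y)) y
      = (fun z => (Metric.ball x δ).indicator F (x + z)) (δ • y) := by
    intro y
    have : y ∈ Metric.ball (0 : Fin 3 → ℝ) 1 ↔ x + δ • y ∈ Metric.ball x δ := by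
      rw [mem_ball_zero_iff, mem_ball_iff_norm, add_sub_cancel_left, norm_smul,
        Real.norm_eq_abs, abs_of_pos hδ]
      constructor <;> intro h <;> nlinarith
    by_cases hy : y ∈ Metric.ball (0 : Fin 3 → ℝ) 1
    · simp only [indicator_of_mem hy, indicator_of_mem (this.1 hy)]
    · simp only [indicator_of_notMem hy, indicator_of_notMem (fun h => hy (this.2 h))]
  simp_rw [e]
  have hemb : MeasurableEmbedding (fun y : Fin 3 → ℝ => δ • y) :=
    (Homeomorph.smulOfNeZero δ hδ.ne').measurableEmbedding
  rw [← hemb.lintegral_map (μ := volume)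
    (fun z => (Metric.ball x δ).indicator F (x + z)), Measure.map_addHaar_smul _ hδ.ne',
    lintegral_smul_measure, lintegral_add_left_eq_self (μ := volume)]
  simp [abs_of_pos hδ]

lemma pointwise_bound (ℓ : ℝ) (hℓ : 1 ≤ ℓ) : ∃ K : ℝ, 0 < K ∧
    ∀ (h : (Fin 3 → ℝ) → ℝ) (S : Set (Fin 3 → ℝ)), IsOpen S → IsHarmonicOn h S →
      ∀ (x : Fin 3 → ℝ) (δ δ' : ℝ), 0 < δ → δ < δ' → Metric.closedBall x δ' ⊆ S →
      ‖h x‖ₑ ^ ℓ ≤ ENNReal.ofReal K * (ENNReal.ofReal ((δ ^ 3)⁻¹) *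
        ∫⁻ z in Metric.ball x δ, ‖h z‖ₑ ^ ℓ) := by
  have hℓ0 : 0 < ℓ := by linarith
  obtain ⟨E, hE⟩ := compact_etaF.exists_bound_of_continuous continuous_etaF
  have hI := etaF_integral_pos
  set I := ∫ y, etaF y with hIdef
  set B := volume (Metric.ball (0 : Fin 3 → ℝ) 1) with hB
  have hBt : B ≠ ∞ := measure_ball_lt_top.ne
  set A : ℝ≥0∞ := (ENNReal.ofReal I)⁻¹ * (ENNReal.ofReal E * B ^ (1 / 1 - 1 / ℓ)) with hA
  have hIne : ENNReal.ofReal I ≠ 0 := by simpa using hI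
  have hexp : 0 ≤ 1 / 1 - 1 / ℓ := by
    have : 1 / ℓ ≤ 1 := by rw [div_le_one hℓ0]; exact hℓ
    linarith
  have hAt : A ≠ ∞ := ENNReal.mul_ne_top (ENNReal.inv_ne_top.2 hIne)
    (ENNReal.mul_ne_top ENNReal.ofReal_ne_top (ENNReal.rpow_ne_top_of_nonneg hexp hBt))
  have hAl : A ^ ℓ ≠ ∞ := ENNReal.rpow_ne_top_of_nonneg hℓ0.le hAt
  refine ⟨(A ^ ℓ).toReal + 1, by positivity, ?_⟩
  intro h S hS hh x δ δ' hδ hδ' hb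
  have h1 := mean_value_local h S hS hh x δ δ' hδ hδ' hb
  rw [← lintegral_scale (fun z => ‖h z‖ₑ ^ ℓ) x δ hδ]
  set f : (Fin 3 → ℝ) → ℝ := fun y => h (x + δ • y) with hf
  have hfm : AEStronglyMeasurable f (volume.restrict (Metric.ball (0 : Fin 3 → ℝ) 1)) := by
    refine ContinuousOn.aestronglyMeasurable ?_ Metric.isOpen_ball.measurableSet
    refine hh.1.continuousOn.comp (by fun_prop) ?_
    intro y hy
    rw [mem_ball_zero_iff] at hy
    refine hb ?_
    rw [mem_closedBall_iff_norm, add_sub_cancel_left, norm_smul, Real.norm_eq_abs, abs_of_pos hδ]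
    nlinarith
  have h2 := eLpNorm'_le_eLpNorm'_mul_rpow_measure_univ (one_pos) hℓ hfm
  simp only [eLpNorm', ENNReal.rpow_one, Measure.restrict_apply_univ, div_one, ← hB] at h2
  have h3 : ‖h x‖ₑ * ENNReal.ofReal I ≤ ENNReal.ofReal E *
      ∫⁻ y in Metric.ball (0 : Fin 3 → ℝ) 1, ‖f y‖ₑ := by
    rw [Real.enorm_eq_ofReal hI.le] at h1
    refine h1.trans ?_
    rw [← lintegral_const_mul' _ _ ENNReal.ofReal_ne_top]
    refine lintegral_mono fun y => ?_
    rw [mul_comm]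
    gcongr
    rw [← ofReal_norm]
    exact ENNReal.ofReal_le_ofReal (hE y)
  have h4 : ‖h x‖ₑ ≤ A * (∫⁻ y in Metric.ball (0 : Fin 3 → ℝ) 1, ‖f y‖ₑ ^ ℓ) ^ (1 / ℓ) := by
    have : ‖h x‖ₑ = (ENNReal.ofReal I)⁻¹ * (‖h x‖ₑ * ENNReal.ofReal I) := by
      rw [mul_comm, mul_assoc, ENNReal.mul_inv_cancel hIne ENNReal.ofReal_ne_top, mul_one]
    rw [this, hA, mul_assoc]
    refine mul_le_mul_right (h3.trans ?_) _
    rw [mul_assoc]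
    refine mul_le_mul_right (h2.trans_eq ?_) _
    rw [mul_comm]; simp
  calc ‖h x‖ₑ ^ ℓ ≤ (A * (∫⁻ y in Metric.ball (0 : Fin 3 → ℝ) 1, ‖f y‖ₑ ^ ℓ) ^ (1 / ℓ)) ^ ℓ :=
        ENNReal.rpow_le_rpow h4 hℓ0.le
    _ = A ^ ℓ * ∫⁻ y in Metric.ball (0 : Fin 3 → ℝ) 1, ‖f y‖ₑ ^ ℓ := by
        rw [ENNReal.mul_rpow_of_nonneg _ _ hℓ0.le, ← ENNReal.rpow_mul,
          one_div_mul_cancel hℓ0.ne', ENNReal.rpow_one]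
    _ ≤ _ := by
        gcongr
        rw [← ENNReal.ofReal_toReal hAl]
        exact ENNReal.ofReal_le_ofReal (by simp)

lemma isOpen_slab (R ρ : ℝ) : IsOpen (slab R ρ) := by
  unfold slab
  have h1 : IsOpen {x : Fin 3 → ℝ | (x 0) ^ 2 + (x 1) ^ 2 < R ^ 2} :=
    isOpen_lt (by fun_prop) (by fun_prop)
  have h2 : IsOpen {x : Fin 3 → ℝ | |x 2| < ρ} := isOpen_lt (by fun_prop) (by fun_prop)
  exact h1.inter h2

lemma closedBall_subset_slab {R r ρ : ℝ} (hr : 0 < r) (hrR : r ≤ R) (hρ : ρ ≤ r / 4)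
    {x : Fin 3 → ℝ} (hx : x ∈ slab R ρ) :
    Metric.closedBall x (3 * r / 5) ⊆ slab (2 * R) r := by
  intro z hz
  rw [Metric.mem_closedBall, dist_pi_le_iff (by positivity)] at hz
  have h0 := hz 0
  have h1 := hz 1
  have h2 := hz 2
  rw [Real.dist_eq] at h0 h1 h2
  obtain ⟨hx1, hx2⟩ := hx
  refine ⟨?_, ?_⟩
  · have e0 : (z 0 - x 0) ^ 2 ≤ (3 * r / 5) ^ 2 := sq_le_sq' (abs_le.1 h0).1 (abs_le.1 h0).2
    have e1 : (z 1 - x 1) ^ 2 ≤ (3 * r / 5) ^ 2 := sq_le_sq' (abs_le.1 h1).1 (abs_le.1 h1).2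
    have e2 : r ^ 2 ≤ R ^ 2 := by gcongr
    -- (a + b)^2 ≤ 2 a^2 + 2 b^2
    nlinarith [sq_nonneg (x 0 - (z 0 - x 0)), sq_nonneg (x 1 - (z 1 - x 1))]
  · have : |z 2| ≤ |z 2 - x 2| + |x 2| := by
      simpa using abs_add_le (z 2 - x 2) (x 2)
    linarith

lemma volume_slab_inter (R r ρ : ℝ) (hr : 0 < r) (z : Fin 3 → ℝ) :
    volume (slab R ρ ∩ Metric.ball z (r / 2)) ≤ ENNReal.ofReal (2 * ρ * r ^ 2) := by
  have hsub : slab R ρ ∩ Metric.ball z (r / 2) ⊆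
      Icc (![z 0 - r / 2, z 1 - r / 2, -ρ]) (![z 0 + r / 2, z 1 + r / 2, ρ]) := by
    rintro y ⟨⟨_, hy⟩, hyz⟩
    rw [Metric.mem_ball, dist_pi_lt_iff (by positivity)] at hyz
    have h0 := hyz 0
    have h1 := hyz 1
    rw [Real.dist_eq, abs_lt] at h0 h1
    rw [abs_lt] at hy
    refine ⟨fun i => ?_, fun i => ?_⟩ <;> fin_cases i <;> simp <;> linarith
  refine (measure_mono hsub).trans_eq ?_
  rw [Real.volume_Icc_pi, Fin.prod_univ_three]
  simp only [Matrix.cons_val]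
  rw [← ENNReal.ofReal_mul (by linarith), ← ENNReal.ofReal_mul (by nlinarith)]
  congr 1; ring

/-- Lemma A.1 of the paper (from Chae–Wolf): interior estimate for harmonic
functions in a thin slab. -/
theorem stmt1 (q ℓ : ℝ) (hℓ : 1 ≤ ℓ) (hℓq : ℓ ≤ q) :
    ∃ C : ℝ, 0 < C ∧ ∀ (R r ρ : ℝ) (h : (Fin 3 → ℝ) → ℝ),
      0 < r → r ≤ R → 0 < ρ → ρ ≤ r / 4 →
      IsHarmonicOn h (slab (2 * R) r) →
      ∫⁻ x in slab R ρ, ENNReal.ofReal (|h x| ^ q) ≤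
        ENNReal.ofReal (C * ρ * r ^ (2 - 3 * q / ℓ)) *
          (∫⁻ x in slab (2 * R) r, ENNReal.ofReal (|h x| ^ ℓ)) ^ (q / ℓ) := by
  obtain ⟨K, hK, hP⟩ := pointwise_bound ℓ hℓ
  have hℓ0 : 0 < ℓ := by linarith
  have hq0 : 0 < q := by linarith
  refine ⟨(8 * K) ^ (q / ℓ) * 2, by positivity, ?_⟩
  intro R r ρ h hr hrR hρ hρr hh
  have conv : ∀ p : ℝ, 0 < p → ∀ x, ENNReal.ofReal (|h x| ^ p) = ‖h x‖ₑ ^ p := by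
    intro p hp x
    rw [← ofReal_norm, Real.norm_eq_abs, ENNReal.ofReal_rpow_of_nonneg (abs_nonneg _) hp.le]
  simp_rw [conv q hq0, conv ℓ hℓ0]
  set S := slab (2 * R) r with hS
  set T := slab R ρ with hT
  have hSo : IsOpen S := isOpen_slab _ _
  have hTo : IsOpen T := isOpen_slab _ _
  set M := ∫⁻ x in S, ‖h x‖ₑ ^ ℓ with hM
  set D : ℝ := 8 * K * (r ^ 3)⁻¹ with hD
  have hDpos : 0 < D := by positivity
  have hballS : ∀ x ∈ T, Metric.ball x (r / 2) ⊆ S := fun x hx =>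
    (Metric.ball_subset_closedBall.trans (Metric.closedBall_subset_closedBall
      (by linarith))).trans (closedBall_subset_slab hr hrR hρr hx)
  have hpt : ∀ x ∈ T, ‖h x‖ₑ ^ ℓ ≤ ENNReal.ofReal D *
      ∫⁻ z in Metric.ball x (r / 2), ‖h z‖ₑ ^ ℓ := by
    intro x hx
    refine (hP h S hSo hh x (r / 2) (3 * r / 5) (by linarith) (by linarith)
      (closedBall_subset_slab hr hrR hρr hx)).trans_eq ?_
    rw [← mul_assoc, ← ENNReal.ofReal_mul hK.le]
    congr 2
    rw [hD]; field_simp; norm_num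
  have hsup : ∀ x ∈ T, ‖h x‖ₑ ^ ℓ ≤ ENNReal.ofReal D * M := fun x hx =>
    (hpt x hx).trans (mul_le_mul_right (lintegral_mono_set (hballS x hx)) _)
  -- measurable extension
  set F : (Fin 3 → ℝ) → ℝ≥0∞ := S.indicator (fun z => ‖h z‖ₑ ^ ℓ) with hF
  have hFm : Measurable F := by
    have h1 : Measurable (S.indicator h) := by
      classical
      rw [← Set.piecewise_eq_indicator]
      exact hh.1.continuousOn.measurable_piecewise
        (continuousOn_const (c := (0 : ℝ)) (s := Sᶜ)) hSo.measurableSet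
    have h2 : F = fun z => ‖S.indicator h z‖ₑ ^ ℓ := by
      ext z
      by_cases hz : z ∈ S
      · simp [hF, hz]
      · simp [hF, hz, hℓ0]
    rw [h2]
    fun_prop
  have hFM : ∫⁻ z, F z = M := lintegral_indicator hSo.measurableSet _
  have hT1 : ∫⁻ x in T, ‖h x‖ₑ ^ ℓ ≤
      ENNReal.ofReal D * (ENNReal.ofReal (2 * ρ * r ^ 2) * M) := by
    calc ∫⁻ x in T, ‖h x‖ₑ ^ ℓ
        ≤ ∫⁻ x in T, ENNReal.ofReal D *
          ∫⁻ z, (Metric.ball z (r / 2)).indicator (fun _ => F z) x := by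
          refine setLIntegral_mono' hTo.measurableSet fun x hx => (hpt x hx).trans ?_
          refine mul_le_mul_right ?_ _
          rw [← lintegral_indicator Metric.isOpen_ball.measurableSet]
          refine lintegral_mono fun z => ?_
          by_cases hz : z ∈ Metric.ball x (r / 2)
          · rw [indicator_of_mem hz, indicator_of_mem (Metric.mem_ball_comm.1 hz), hF,
              indicator_of_mem (hballS x hx hz)]
          · rw [indicator_of_notMem hz]; exact zero_le
      _ = ENNReal.ofReal D * ∫⁻ x in T,
          ∫⁻ z, (Metric.ball z (r / 2)).indicator (fun _ => F z) x :=
          lintegral_const_mul' _ _ ENNReal.ofReal_ne_top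
      _ = ENNReal.ofReal D * ∫⁻ z, ∫⁻ x in T,
          (Metric.ball z (r / 2)).indicator (fun _ => F z) x := by
          rw [lintegral_lintegral_swap]
          have hms : MeasurableSet {p : (Fin 3 → ℝ) × (Fin 3 → ℝ) | dist p.1 p.2 < r / 2} :=
            (isOpen_lt (by fun_prop) (by fun_prop)).measurableSet
          have := ((hFm.comp measurable_snd).indicator hms :
            Measurable ({p : (Fin 3 → ℝ) × (Fin 3 → ℝ) | dist p.1 p.2 < r / 2}.indicator
              (F ∘ Prod.snd)))
          refine Measurable.aemeasurable ?_
          convert this using 1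
          ext ⟨a, c⟩
          simp [Function.uncurry, indicator]
      _ ≤ ENNReal.ofReal D * ∫⁻ z, ENNReal.ofReal (2 * ρ * r ^ 2) * F z := by
          gcongr with z
          rw [lintegral_indicator_const Metric.isOpen_ball.measurableSet, mul_comm,
            Measure.restrict_apply Metric.isOpen_ball.measurableSet, inter_comm]
          gcongr
          exact volume_slab_inter R r ρ hr z
      _ = _ := by
          rw [lintegral_const_mul' _ _ ENNReal.ofReal_ne_top, hFM]
  have hs : 0 ≤ q / ℓ - 1 := by
    rw [sub_nonneg, one_le_div hℓ0]; exact hℓq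
  have hT2 : ∫⁻ x in T, ‖h x‖ₑ ^ q ≤
      ∫⁻ x in T, (ENNReal.ofReal D * M) ^ (q / ℓ - 1) * ‖h x‖ₑ ^ ℓ := by
    refine setLIntegral_mono' hTo.measurableSet fun x hx => ?_
    have : ‖h x‖ₑ ^ q = (‖h x‖ₑ ^ ℓ) ^ (q / ℓ - 1) * ‖h x‖ₑ ^ ℓ := by
      rw [← ENNReal.rpow_mul, ← ENNReal.rpow_add_of_nonneg _ _ (by positivity) hℓ0.le]
      congr 1; field_simp; ring
    rw [this]
    gcongr
    exact hsup x hx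
  by_cases hMt : M = ∞
  · rw [hMt, ENNReal.top_rpow_of_pos (by positivity), ENNReal.mul_top]
    · exact le_top
    · rw [ne_eq, ENNReal.ofReal_eq_zero, not_le]; positivity
  refine hT2.trans ?_
  rw [lintegral_const_mul' _ _ (ENNReal.rpow_ne_top_of_nonneg hs
    (ENNReal.mul_ne_top ENNReal.ofReal_ne_top hMt))]
  refine (mul_le_mul_right hT1 _).trans_eq ?_
  have e1 : (ENNReal.ofReal D * M) ^ (q / ℓ - 1) *
      (ENNReal.ofReal D * (ENNReal.ofReal (2 * ρ * r ^ 2) * M)) =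
      ENNReal.ofReal (2 * ρ * r ^ 2) * ((ENNReal.ofReal D * M) ^ (q / ℓ - 1) *
        (ENNReal.ofReal D * M) ^ (1 : ℝ)) := by
    rw [ENNReal.rpow_one]; ring
  rw [e1, ← ENNReal.rpow_add_of_nonneg _ _ hs zero_le_one, sub_add_cancel,
    ENNReal.mul_rpow_of_nonneg _ _ (by positivity),
    ENNReal.ofReal_rpow_of_nonneg hDpos.le (by positivity), ← mul_assoc,
    ← ENNReal.ofReal_mul (by positivity)]
  congr 2
  rw [hD, Real.mul_rpow (by positivity) (by positivity), Real.inv_rpow (by positivity),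
    ← Real.rpow_natCast, ← Real.rpow_natCast, ← Real.rpow_mul hr.le, Real.rpow_sub hr]
  have : ((3 : ℕ) : ℝ) * (q / ℓ) = 3 * q / ℓ := by push_cast; ring
  rw [this]
  push_cast
  field_simp
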